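/- For all 0 < α ≤ 1/2 and 0 < β ≤ 1/2, the sequence n ↦ Γ_B^(n)(⌊α·2^n⌋, 2⌊βn/2⌋+1) converges as n → ∞, and its limit equals Γ_IID(α,β). -/

import Mathlib

open Finset

noncomputable section

/-- The Hamming ball of radius `r` around the all-ones vector in `{-1,1}^n`
(vertices modeled as `Fin n → ℤˣ`, where `ℤˣ = {1, -1}`). -/
def hBall (n r : ℕ) : Finset (Fin n → ℤˣ) :=
  Finset.univ.filter fun z => hammingDist z 1 ≤ r

/-- The Hamming sphere of radius `r` around the all-ones vector. -/
def hSphere (n r : ℕ) : Finset (Fin n → ℤˣ) :=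
  Finset.univ.filter fun z => hammingDist z 1 = r

/-- Ball-noise stability `E[f(X) f(X∘Z)]`, `X` uniform on the cube, `Z` uniform on `B_r`. -/
def BStab (n r : ℕ) (f : (Fin n → ℤˣ) → ℝ) : ℝ :=
  (∑ x : Fin n → ℤˣ, ∑ z ∈ hBall n r, f x * f (x * z)) / (2 ^ n * (hBall n r).card)

/-- Sphere-noise stability `E[f(X) f(X∘Z)]`, `X` uniform on the cube, `Z` uniform on `S_r`. -/
def SStab (n r : ℕ) (f : (Fin n → ℤˣ) → ℝ) : ℝ :=
  (∑ x : Fin n → ℤˣ, ∑ z ∈ hSphere n r, f x * f (x * z)) / (2 ^ n * (hSphere n r).card)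

/-- i.i.d.-noise stability `E[f(X) f(X∘Z)]`, `Z` with i.i.d. coordinates equal to `-1`
with probability `β` and `1` with probability `1-β`. -/
def Stab (n : ℕ) (β : ℝ) (f : (Fin n → ℤˣ) → ℝ) : ℝ :=
  (∑ x : Fin n → ℤˣ, ∑ z : Fin n → ℤˣ,
      (∏ i, if z i = 1 then 1 - β else β) * (f x * f (x * z))) / 2 ^ n

/-- Indicator function of a set `A` of vertices. -/
def indic (n : ℕ) (A : Finset (Fin n → ℤˣ)) : (Fin n → ℤˣ) → ℝ :=
  fun x => if x ∈ A then 1 else 0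

/-- `Γ_B^(n)(M,r)`: maximal ball-noise stability over Boolean functions with exactly `M` ones. -/
def GammaB (n M r : ℕ) : ℝ :=
  sSup {y | ∃ A : Finset (Fin n → ℤˣ), A.card = M ∧ y = BStab n r (indic n A)}

/-- `Γ_S^(n)(M,r)`: maximal sphere-noise stability over Boolean functions with exactly `M` ones. -/
def GammaS (n M r : ℕ) : ℝ :=
  sSup {y | ∃ A : Finset (Fin n → ℤˣ), A.card = M ∧ y = SStab n r (indic n A)}

/-- `Γ_IID^(n)(M,β)`: maximal i.i.d.-noise stability over Boolean functions with exactly `M` ones. -/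
def GammaIID (n M : ℕ) (β : ℝ) : ℝ :=
  sSup {y | ∃ A : Finset (Fin n → ℤˣ), A.card = M ∧ y = Stab n β (indic n A)}

/-- `Γ_IID(α,β) := sup_n Γ_IID^(n)(⌊α·2^n⌋, β)` (equivalently the limit, by monotonicity). -/
def GammaIIDlim (α β : ℝ) : ℝ := ⨆ n : ℕ, GammaIID n ⌊α * 2 ^ n⌋₊ β

/-- `C(n, ≤ r) = Σ_{i=0}^r C(n,i)`. -/
def ballBinom (n r : ℕ) : ℕ := ∑ i ∈ Finset.range (r + 1), n.choose i

open Filter Topology Polynomial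

/-- The coefficient of `X ^ r` in `(1 - X) ^ k * (1 + X) ^ m`: the value at `k` of the Krawtchouk
polynomial of degree `r` on the cube of dimension `k + m`. -/
def krawtchouk (r k m : ℕ) : ℝ := ((1 - X) ^ k * (1 + X) ^ m : ℝ[X]).coeff r

theorem krawtchouk_swap (r k m : ℕ) : krawtchouk r m k = (-1) ^ r * krawtchouk r k m := by
  have h : ((1 - X) ^ m * (1 + X) ^ k : ℝ[X])
      = ((1 - X) ^ k * (1 + X) ^ m : ℝ[X]).comp (C (-1) * X) := by
    simp only [mul_comp, pow_comp, sub_comp, add_comp, one_comp, X_comp, map_neg, map_one]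
    ring
  rw [krawtchouk, h, comp_C_mul_X_coeff, krawtchouk, mul_comm]

theorem krawtchouk_zero_left (r m : ℕ) : krawtchouk r 0 m = m.choose r := by
  simp [krawtchouk, coeff_one_add_X_pow]

theorem abs_coeff_mul_le {p p' q q' : ℝ[X]} (hp : ∀ i, |p.coeff i| ≤ p'.coeff i)
    (hq : ∀ i, |q.coeff i| ≤ q'.coeff i) (i : ℕ) : |(p * q).coeff i| ≤ (p' * q').coeff i := by
  rw [coeff_mul, coeff_mul]
  refine (abs_sum_le_sum_abs _ _).trans (sum_le_sum fun x _ => ?_)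
  rw [abs_mul]
  exact mul_le_mul (hp _) (hq _) (abs_nonneg _) ((abs_nonneg _).trans (hp _))

theorem abs_coeff_pow_le {p p' : ℝ[X]} (hp : ∀ i, |p.coeff i| ≤ p'.coeff i) (k i : ℕ) :
    |(p ^ k).coeff i| ≤ (p' ^ k).coeff i := by
  induction k generalizing i with
  | zero => simp only [pow_zero, coeff_one]; split_ifs <;> simp
  | succ k ih => simpa only [pow_succ] using abs_coeff_mul_le ih hp i

theorem abs_coeff_one_sub_X_le (i : ℕ) : |(1 - X : ℝ[X]).coeff i| ≤ (1 + X : ℝ[X]).coeff i := by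
  rcases i with _ | _ | i <;> simp [coeff_one, coeff_X]

theorem abs_coeff_one_add_X_le (i : ℕ) : |(1 + X : ℝ[X]).coeff i| ≤ (1 + X : ℝ[X]).coeff i := by
  rcases i with _ | _ | i <;> simp [coeff_one, coeff_X]

theorem abs_coeff_one_sub_X_sq_le (i : ℕ) :
    |(1 - X ^ 2 : ℝ[X]).coeff i| ≤ (1 + X ^ 2 : ℝ[X]).coeff i := by
  rcases i with _ | _ | _ | i <;> simp [coeff_one, coeff_X_pow]

/-- Cancelling `l` factors `1 - X` against `l` factors `1 + X` bounds the Krawtchouk polynomial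
uniformly in the middle range. -/
theorem abs_krawtchouk_le_of_le (r k m l : ℕ) (hk : l ≤ k) (hm : l ≤ m) :
    |krawtchouk r k m| ≤
      (∑ j ∈ range (l + 1), l.choose j * krawtchouk r (2 * j) (k + m - 2 * j)) / 2 ^ l := by
  obtain ⟨k, rfl⟩ := Nat.exists_eq_add_of_le hk
  obtain ⟨m, rfl⟩ := Nat.exists_eq_add_of_le hm
  have h1 : ((1 - X) ^ (l + k) * (1 + X) ^ (l + m) : ℝ[X])
      = (1 - X ^ 2) ^ l * ((1 - X) ^ k * (1 + X) ^ m) := by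
    rw [show (1 - X ^ 2 : ℝ[X]) = (1 - X) * (1 + X) by ring, mul_pow]; ring
  have h2 : (1 + X ^ 2 : ℝ[X]) ^ l * ((1 + X) ^ k * (1 + X) ^ m)
      = C ((2 ^ l)⁻¹ : ℝ) * ∑ j ∈ range (l + 1),
        C (l.choose j : ℝ) * ((1 - X) ^ (2 * j) * (1 + X) ^ (l + k + (l + m) - 2 * j)) := by
    have h3 : (1 + X ^ 2 : ℝ[X]) = C (2⁻¹ : ℝ) * ((1 - X) ^ 2 + (1 + X) ^ 2) := by
      have : (C (2⁻¹ : ℝ) * 2 : ℝ[X]) = 1 := by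
        rw [← C_ofNat, ← C_mul]; norm_num
      linear_combination (-1 - X ^ 2 : ℝ[X]) * this
    rw [h3, mul_pow, ← C_pow, inv_pow, mul_assoc, add_pow, Finset.sum_mul]
    congr 1
    refine sum_congr rfl fun j hj => ?_
    have hj := mem_range.1 hj
    rw [show l + k + (l + m) - 2 * j = 2 * (l - j) + (k + m) by omega]
    simp only [pow_mul, pow_add, map_natCast]
    ring
  have := abs_coeff_mul_le (abs_coeff_pow_le abs_coeff_one_sub_X_sq_le l)
    (abs_coeff_mul_le (abs_coeff_pow_le abs_coeff_one_sub_X_le k)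
    (abs_coeff_pow_le abs_coeff_one_add_X_le m)) r
  rw [h2, ← h1, coeff_C_mul, finsetSum_coeff] at this
  simp only [coeff_C_mul] at this
  rw [div_eq_inv_mul]
  exact this

theorem krawtchouk_eq_sum {r k N : ℕ} (hN : k ≤ N) (hr : k ≤ r) :
    krawtchouk r k (N - k) =
      ∑ j ∈ range (k + 1), k.choose j * (-2) ^ j * ((N - j).choose (r - j) : ℝ) := by
  have h : ((1 - X) ^ k * (1 + X) ^ (N - k) : ℝ[X])
      = ∑ j ∈ range (k + 1), C (k.choose j * (-2) ^ j : ℝ) * (X ^ j * (1 + X) ^ (N - j)) := by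
    rw [show (1 - X : ℝ[X]) = -2 * X + (1 + X) by ring, add_pow, Finset.sum_mul]
    refine sum_congr rfl fun j hj => ?_
    have hj := mem_range.1 hj
    rw [show N - j = (k - j) + (N - k) by omega]
    simp only [pow_add, mul_pow, map_mul, map_pow, map_neg, map_natCast, C_ofNat]
    ring
  rw [krawtchouk, h, finsetSum_coeff]
  refine sum_congr rfl fun j hj => ?_
  have hj := mem_range.1 hj
  rw [coeff_C_mul, coeff_X_pow_mul', if_pos (by omega), coeff_one_add_X_pow]

theorem sum_range_krawtchouk_succ (r k m : ℕ) :
    ∑ i ∈ range (r + 1), krawtchouk i (k + 1) m = krawtchouk r k m := by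
  have h : ((1 - X) ^ (k + 1) * (1 + X) ^ m : ℝ[X])
      = (1 - X) ^ k * (1 + X) ^ m - X * ((1 - X) ^ k * (1 + X) ^ m) := by ring
  induction r with
  | zero => simp [krawtchouk, h]
  | succ r ih =>
    rw [sum_range_succ, ih, krawtchouk, krawtchouk, krawtchouk, h, coeff_sub, coeff_X_mul]
    ring

theorem sum_range_choose_mul_sub (n r : ℕ) :
    ∑ i ∈ range (r + 1), ((n + 1).choose i : ℝ) * (n + 1 - 2 * i) = (n + 1) * n.choose r := by
  induction r with
  | zero => simp
  | succ r ih =>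
    rw [sum_range_succ, ih]
    have h1 : ((n + 1 : ℕ) : ℝ) * n.choose r = (n + 1).choose (r + 1) * (r + 1 : ℕ) := by
      exact_mod_cast Nat.add_one_mul_choose_eq n r
    have h2 : ((n + 1).choose (r + 1) : ℝ) = n.choose r + n.choose (r + 1) := by
      exact_mod_cast Nat.choose_succ_succ n r
    push_cast at h1 ⊢
    linear_combination 2 * h1 + (n + 1) * h2

theorem sum_range_choose_mul_sub_sq (n r : ℕ) :
    ∑ i ∈ range (r + 1), ((n + 1).choose i : ℝ) * ((n : ℝ) + 1 - 2 * i) ^ 2 =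
      ((n : ℝ) + 1) * ballBinom (n + 1) r + (n + 1) * n.choose r * (n - 2 * r) := by
  rw [ballBinom]
  induction r with
  | zero => simp; ring
  | succ r ih =>
    rw [sum_range_succ, ih, sum_range_succ _ (r + 1)]
    have h1 : ((n + 1 : ℕ) : ℝ) * n.choose r = (n + 1).choose (r + 1) * (r + 1 : ℕ) := by
      exact_mod_cast Nat.add_one_mul_choose_eq n r
    have h2 : ((n + 1).choose (r + 1) : ℝ) = n.choose r + n.choose (r + 1) := by
      exact_mod_cast Nat.choose_succ_succ n r
    push_cast at h1 ⊢
    linear_combination (2 * n - 4 * r - 2) * h1 + (n + 1) * (n - 2 * (r + 1)) * h2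

theorem ballBinom_pos (n r : ℕ) : 0 < ballBinom n r := by
  rw [ballBinom, sum_range_succ']
  simp

theorem choose_le_ballBinom_succ (n r : ℕ) : n.choose r ≤ ballBinom (n + 1) r :=
  (Nat.choose_le_choose r n.le_succ).trans
    (single_le_sum (f := fun i => (n + 1).choose i) (fun _ _ => Nat.zero_le _)
      (self_mem_range_succ r))

theorem sub_le_choose_div_ballBinom (n r : ℕ) :
    1 - 2 * (r / (n + 1) : ℝ) ≤ n.choose r / ballBinom (n + 1) r := by
  have hB : (0 : ℝ) < ballBinom (n + 1) r := by exact_mod_cast ballBinom_pos _ _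
  have hn : (0 : ℝ) < n + 1 := by positivity
  have h : ((n : ℝ) + 1 - 2 * r) * ballBinom (n + 1) r ≤ (n + 1) * n.choose r := by
    rw [← sum_range_choose_mul_sub, ballBinom, Nat.cast_sum, mul_sum]
    refine sum_le_sum fun i hi => ?_
    have : (i : ℝ) ≤ r := by exact_mod_cast Nat.lt_succ_iff.1 (mem_range.1 hi)
    rw [mul_comm]
    gcongr
  rw [le_div_iff₀ hB]
  have : (1 - 2 * (r / (n + 1) : ℝ)) = ((n : ℝ) + 1 - 2 * r) / (n + 1) := by field_simp
  rw [this, div_mul_eq_mul_div, div_le_iff₀ hn]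
  linarith

theorem choose_div_ballBinom_sq_le (n r : ℕ) :
    (n.choose r / ballBinom (n + 1) r : ℝ) ^ 2 ≤
      1 / ((n : ℝ) + 1) + n.choose r / ballBinom (n + 1) r *
        (1 - 1 / ((n : ℝ) + 1) - 2 * (r / (n + 1) : ℝ)) := by
  have hB : (0 : ℝ) < ballBinom (n + 1) r := by exact_mod_cast ballBinom_pos _ _
  have hn : (0 : ℝ) < n + 1 := by positivity
  have h := sum_sq_le_sum_mul_sum_of_sq_le_mul (range (r + 1))
    (r := fun i => ((n + 1).choose i : ℝ) * (n + 1 - 2 * i))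
    (f := fun i => ((n + 1).choose i : ℝ))
    (g := fun i => ((n + 1).choose i : ℝ) * (n + 1 - 2 * i) ^ 2)
    (fun _ _ => by positivity) (fun _ _ => by positivity) (fun _ _ => by rw [mul_pow]; ring_nf; rfl)
  rw [sum_range_choose_mul_sub, sum_range_choose_mul_sub_sq, ← Nat.cast_sum] at h
  change _ ≤ (ballBinom (n + 1) r : ℝ) * _ at h
  generalize (ballBinom (n + 1) r : ℝ) = B at *
  have : 1 / ((n : ℝ) + 1) + n.choose r / B * (1 - 1 / ((n : ℝ) + 1) - 2 * (r / (n + 1) : ℝ))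
      = (B * ((n + 1) * B + (n + 1) * n.choose r * (n - 2 * r))) / ((n + 1) ^ 2 * B ^ 2) := by
    field_simp
    ring
  rw [this, le_div_iff₀ (by positivity), div_pow]
  calc _ = ((n + 1) * n.choose r : ℝ) ^ 2 := by field_simp
    _ ≤ _ := h

theorem eventually_le_of_tendsto_div {r : ℕ → ℕ} {β : ℝ} (hβ : 0 < β)
    (hr : Tendsto (fun N : ℕ => (r N : ℝ) / N) atTop (𝓝 β)) (j : ℕ) :
    ∀ᶠ N in atTop, j ≤ r N := by
  have h := (hr.pos_mul_atTop hβ tendsto_natCast_atTop_atTop).eventually_ge_atTop (j : ℝ)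
  filter_upwards [h, eventually_gt_atTop 0] with N hN h0
  have : (N : ℝ) ≠ 0 := by positivity
  rw [div_mul_cancel₀ _ this] at hN
  exact_mod_cast hN

theorem tendsto_choose_sub_div_choose {r : ℕ → ℕ} {β : ℝ} (hβ : 0 < β)
    (hle : ∀ᶠ N in atTop, r N ≤ N)
    (hr : Tendsto (fun N : ℕ => (r N : ℝ) / N) atTop (𝓝 β)) (j : ℕ) :
    Tendsto (fun N : ℕ => ((N - j).choose (r N - j) : ℝ) / N.choose (r N)) atTop
      (𝓝 (β ^ j)) := by
  induction j with
  | zero =>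
    refine tendsto_const_nhds.congr' ?_
    filter_upwards [hle] with N hN
    have : (N.choose (r N) : ℝ) ≠ 0 := by exact_mod_cast (Nat.choose_pos hN).ne'
    simp [div_self this]
  | succ j ih =>
    have hinv : Tendsto (fun N : ℕ => (j : ℝ) / N) atTop (𝓝 0) :=
      tendsto_const_div_atTop_nhds_zero_nat _
    have hfac : Tendsto (fun N : ℕ => ((r N : ℝ) / N - j / N) / (1 - j / N)) atTop (𝓝 β) := by
      have h := (hr.sub hinv).div ((tendsto_const_nhds (x := (1 : ℝ))).sub hinv) (by norm_num)
      rwa [sub_zero, sub_zero, div_one] at h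
    rw [pow_succ]
    refine (ih.mul hfac).congr' ?_
    filter_upwards [hle, eventually_le_of_tendsto_div hβ hr (j + 1)] with N hN hj
    have hC : (N.choose (r N) : ℝ) ≠ 0 := by exact_mod_cast (Nat.choose_pos hN).ne'
    obtain ⟨s, hs⟩ := Nat.exists_eq_add_of_le' hj
    obtain ⟨M, rfl⟩ := Nat.exists_eq_add_of_le' (hj.trans hN)
    rw [show M + (j + 1) - (j + 1) = M by omega, show M + (j + 1) - j = M + 1 by omega,
      show r (M + (j + 1)) - (j + 1) = s by omega, show r (M + (j + 1)) - j = s + 1 by omega]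
    have h1 : ((M + 1 : ℕ) : ℝ) * M.choose s = (M + 1).choose (s + 1) * (s + 1 : ℕ) := by
      exact_mod_cast Nat.add_one_mul_choose_eq M s
    have hrs : (r (M + (j + 1)) : ℝ) = s + (j + 1) := by exact_mod_cast hs
    have hM : ((M + (j + 1) : ℕ) : ℝ) ≠ 0 := by positivity
    have h2 : ((r (M + (j + 1)) : ℝ) / (M + (j + 1) : ℕ) - j / (M + (j + 1) : ℕ)) /
        (1 - j / (M + (j + 1) : ℕ)) = (s + 1) / (M + 1) := by
      rw [← sub_div, one_sub_div hM, div_div_div_cancel_right₀ hM, hrs]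
      push_cast
      congr 1 <;> ring
    rw [h2, div_mul_div_comm, div_eq_div_iff (by positivity) hC]
    push_cast at h1
    linear_combination (-(M + (j + 1)).choose (r (M + (j + 1))) : ℝ) * h1

theorem tendsto_krawtchouk_div_choose {r : ℕ → ℕ} {β : ℝ} (hβ : 0 < β)
    (hle : ∀ᶠ N in atTop, r N ≤ N)
    (hr : Tendsto (fun N : ℕ => (r N : ℝ) / N) atTop (𝓝 β)) (k : ℕ) :
    Tendsto (fun N : ℕ => krawtchouk (r N) k (N - k) / N.choose (r N)) atTop
      (𝓝 ((1 - 2 * β) ^ k)) := by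
  have h : Tendsto (fun N : ℕ => ∑ j ∈ range (k + 1), (k.choose j * (-2) ^ j : ℝ) *
      (((N - j).choose (r N - j) : ℝ) / N.choose (r N))) atTop
      (𝓝 (∑ j ∈ range (k + 1), (k.choose j * (-2) ^ j : ℝ) * β ^ j)) :=
    tendsto_finsetSum _ fun j _ => (tendsto_choose_sub_div_choose hβ hle hr j).const_mul _
  have he : (1 - 2 * β) ^ k = ∑ j ∈ range (k + 1), (k.choose j * (-2) ^ j : ℝ) * β ^ j := by
    rw [show 1 - 2 * β = -2 * β + 1 by ring, add_pow]
    refine sum_congr rfl fun j _ => ?_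
    rw [mul_pow, one_pow]; ring
  rw [he]
  refine h.congr' ?_
  filter_upwards [eventually_ge_atTop k, eventually_le_of_tendsto_div hβ hr k] with N hN hk
  rw [krawtchouk_eq_sum hN hk, sum_div]
  exact sum_congr rfl fun j _ => (mul_div_assoc _ _ _).symm

theorem tendsto_choose_div_ballBinom {r : ℕ → ℕ} {β : ℝ} (hβ2 : β ≤ 1 / 2)
    (hr : Tendsto (fun N : ℕ => (r N : ℝ) / N) atTop (𝓝 β)) :
    Tendsto (fun N : ℕ => (N.choose (r N) : ℝ) / ballBinom (N + 1) (r N)) atTop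
      (𝓝 (1 - 2 * β)) := by
  have hinv : Tendsto (fun N : ℕ => 1 / ((N : ℝ) + 1)) atTop (𝓝 0) :=
    tendsto_one_div_add_atTop_nhds_zero_nat
  have hr' : Tendsto (fun N : ℕ => (r N : ℝ) / (N + 1)) atTop (𝓝 β) := by
    have h : Tendsto (fun N : ℕ => (r N : ℝ) / N * (1 - 1 / ((N : ℝ) + 1))) atTop (𝓝 β) := by
      simpa using hr.mul ((tendsto_const_nhds (x := (1 : ℝ))).sub hinv)
    refine h.congr' ?_
    filter_upwards [eventually_gt_atTop 0] with N hN
    field_simp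
    ring
  have hlo : Tendsto (fun N : ℕ => 1 - 2 * ((r N : ℝ) / (N + 1))) atTop (𝓝 (1 - 2 * β)) :=
    tendsto_const_nhds.sub (hr'.const_mul 2)
  have hd : Tendsto (fun N : ℕ => 1 - 1 / ((N : ℝ) + 1) - 2 * ((r N : ℝ) / (N + 1))) atTop
      (𝓝 (1 - 2 * β)) := by
    simpa using (tendsto_const_nhds.sub hinv).sub (hr'.const_mul 2)
  have hup : Tendsto (fun N : ℕ => (1 - 1 / ((N : ℝ) + 1) - 2 * ((r N : ℝ) / (N + 1))) / 2 +
      √(1 / ((N : ℝ) + 1) + ((1 - 1 / ((N : ℝ) + 1) - 2 * ((r N : ℝ) / (N + 1))) / 2) ^ 2))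
      atTop (𝓝 (1 - 2 * β)) := by
    have h := (hd.div_const 2).add
      ((Real.continuous_sqrt.tendsto _).comp (hinv.add ((hd.div_const 2).pow 2)))
    have he : (1 - 2 * β) / 2 + √(0 + ((1 - 2 * β) / 2) ^ 2) = 1 - 2 * β := by
      rw [zero_add, Real.sqrt_sq (by linarith)]; ring
    rw [he] at h
    exact h
  refine tendsto_of_tendsto_of_tendsto_of_le_of_le hlo hup
    (fun N => sub_le_choose_div_ballBinom N (r N)) fun N => ?_
  have h := choose_div_ballBinom_sq_le N (r N)
  have := Real.le_sqrt_of_sq_le (x := (N.choose (r N) : ℝ) / ballBinom (N + 1) (r N) -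
    (1 - 1 / ((N : ℝ) + 1) - 2 * ((r N : ℝ) / (N + 1))) / 2)
    (y := 1 / ((N : ℝ) + 1) + ((1 - 1 / ((N : ℝ) + 1) - 2 * ((r N : ℝ) / (N + 1))) / 2) ^ 2)
    (by nlinarith [h])
  simp only at this ⊢
  linarith

/-- The eigenvalue, on characters of level `k`, of averaging over the Hamming ball of
radius `r` in dimension `n`. -/
def ballEigenvalue (n r k : ℕ) : ℝ :=
  (∑ i ∈ range (r + 1), krawtchouk i k (n - k)) / ballBinom n r

theorem ballEigenvalue_zero (n r : ℕ) : ballEigenvalue n r 0 = 1 := by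
  have hB : (ballBinom n r : ℝ) ≠ 0 := by exact_mod_cast (ballBinom_pos _ _).ne'
  simp only [ballEigenvalue, krawtchouk_zero_left, Nat.sub_zero]
  rw [← Nat.cast_sum]
  exact div_self hB

theorem ballEigenvalue_succ {N r : ℕ} (hr : r ≤ N) (k : ℕ) :
    ballEigenvalue (N + 1) r (k + 1) =
      N.choose r / ballBinom (N + 1) r * (krawtchouk r k (N - k) / N.choose r) := by
  have hC : (N.choose r : ℝ) ≠ 0 := by exact_mod_cast (Nat.choose_pos hr).ne'
  rw [ballEigenvalue, Nat.add_sub_add_right, sum_range_krawtchouk_succ]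
  field_simp

theorem tendsto_ballEigenvalue {r : ℕ → ℕ} {β : ℝ} (hβ : 0 < β) (hβ2 : β ≤ 1 / 2)
    (hle : ∀ᶠ N in atTop, r N ≤ N)
    (hr : Tendsto (fun N : ℕ => (r N : ℝ) / N) atTop (𝓝 β)) (k : ℕ) :
    Tendsto (fun N : ℕ => ballEigenvalue (N + 1) (r N) k) atTop (𝓝 ((1 - 2 * β) ^ k)) := by
  rcases k with _ | k
  · simp [ballEigenvalue_zero]
  · rw [pow_succ']
    refine ((tendsto_choose_div_ballBinom hβ2 hr).mul
      (tendsto_krawtchouk_div_choose hβ hle hr k)).congr' ?_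
    filter_upwards [hle] with N hN
    rw [ballEigenvalue_succ hN]

theorem tendsto_middle_bound {r : ℕ → ℕ} {β : ℝ} (hβ : 0 < β)
    (hle : ∀ᶠ N in atTop, r N ≤ N)
    (hr : Tendsto (fun N : ℕ => (r N : ℝ) / N) atTop (𝓝 β)) (l : ℕ) :
    Tendsto (fun N : ℕ => (∑ j ∈ range (l + 1), l.choose j *
      krawtchouk (r N) (2 * j) (N - 2 * j)) / 2 ^ l / N.choose (r N)) atTop
      (𝓝 (((1 + (1 - 2 * β) ^ 2) / 2) ^ l)) := by
  have h := (tendsto_finsetSum (range (l + 1)) fun j _ =>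
    (tendsto_krawtchouk_div_choose hβ hle hr (2 * j)).const_mul (l.choose j : ℝ)).div_const (2 ^ l)
  have he : ((1 + (1 - 2 * β) ^ 2) / 2) ^ l =
      (∑ j ∈ range (l + 1), l.choose j * (1 - 2 * β) ^ (2 * j)) / 2 ^ l := by
    rw [div_pow, add_comm, add_pow]
    congr 1
    refine sum_congr rfl fun j _ => ?_
    rw [one_pow, pow_mul]; ring
  rw [he]
  refine h.congr fun N => ?_
  simp only [← mul_div_assoc]
  rw [← sum_div, div_right_comm]

/-- For odd radii, the ball eigenvalues are asymptotically bounded by those of i.i.d. noise,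
uniformly in the level. -/
theorem eventually_ballEigenvalue_le {r : ℕ → ℕ} {β : ℝ} (hβ : 0 < β) (hβ2 : β ≤ 1 / 2)
    (hle : ∀ᶠ N in atTop, r N ≤ N) (hodd : ∀ N, Odd (r N))
    (hr : Tendsto (fun N : ℕ => (r N : ℝ) / N) atTop (𝓝 β)) {ε : ℝ} (hε : 0 < ε) :
    ∀ᶠ N : ℕ in atTop, ∀ k ≤ N + 1,
      ballEigenvalue (N + 1) (r N) k ≤ (1 - 2 * β) ^ k + ε := by
  obtain ⟨l, hl⟩ := exists_pow_lt_of_lt_one hε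
    (show (1 + (1 - 2 * β) ^ 2) / 2 < 1 by nlinarith)
  have hmid := (tendsto_middle_bound hβ hle hr l).eventually_lt_const hl
  have hsmall : ∀ᶠ N in atTop, ∀ k ∈ range (l + 1),
      ballEigenvalue (N + 1) (r N) k < (1 - 2 * β) ^ k + ε :=
    (eventually_all_finset _).2 fun k _ =>
      (tendsto_ballEigenvalue hβ hβ2 hle hr k).eventually_lt_const (by linarith)
  have hlarge : ∀ᶠ N in atTop, ∀ k ∈ range l,
      -ε < krawtchouk (r N) k (N - k) / N.choose (r N) :=
    (eventually_all_finset _).2 fun k _ =>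
      (tendsto_krawtchouk_div_choose hβ hle hr k).eventually_const_lt
        (by have : 0 ≤ (1 - 2 * β) ^ k := pow_nonneg (by linarith) _
            linarith)
  filter_upwards [hle, hmid, hsmall, hlarge] with N hN hmid hsmall hlarge k hk
  by_cases hkl : k < l + 1
  · exact (hsmall k (mem_range.2 hkl)).le
  obtain ⟨k, rfl⟩ := Nat.exists_eq_add_of_le' (show 1 ≤ k by omega)
  have hpow : 0 ≤ (1 - 2 * β) ^ (k + 1) := pow_nonneg (by linarith) _
  have hB : (0 : ℝ) < ballBinom (N + 1) (r N) := by exact_mod_cast ballBinom_pos _ _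
  have hC : (0 : ℝ) < N.choose (r N) := by exact_mod_cast Nat.choose_pos hN
  have hc1 : (N.choose (r N) : ℝ) / ballBinom (N + 1) (r N) ≤ 1 := by
    rw [div_le_one hB]; exact_mod_cast choose_le_ballBinom_succ _ _
  have hc0 : 0 ≤ (N.choose (r N) : ℝ) / ballBinom (N + 1) (r N) := by positivity
  suffices h : krawtchouk (r N) k (N - k) / N.choose (r N) ≤ ε by
    rw [ballEigenvalue_succ hN]
    nlinarith
  by_cases hkN : l ≤ N - k
  · have h := abs_krawtchouk_le_of_le (r N) k (N - k) l (by omega) hkN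
    rw [show k + (N - k) = N by omega] at h
    refine le_trans ?_ hmid.le
    gcongr
    exact (le_abs_self _).trans h
  · have h := hlarge (N - k) (mem_range.2 (by omega))
    rw [krawtchouk_swap, (hodd N).neg_one_pow, show N - (N - k) = k by omega, neg_one_mul,
      neg_div] at h
    linarith

/-- The Walsh character `x ↦ ∏ i ∈ S, x i`. -/
def walsh {n : ℕ} (S : Finset (Fin n)) (x : Fin n → ℤˣ) : ℝ := ∏ i ∈ S, ((x i : ℤ) : ℝ)

theorem walsh_mul {n : ℕ} (S : Finset (Fin n)) (x y : Fin n → ℤˣ) :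
    walsh S (x * y) = walsh S x * walsh S y := by
  simp [walsh, prod_mul_distrib]

theorem cube_mul_self {n : ℕ} (x : Fin n → ℤˣ) : x * x = 1 :=
  funext fun i => Int.units_mul_self (x i)

theorem sum_walsh {n : ℕ} (x : Fin n → ℤˣ) :
    ∑ S : Finset (Fin n), walsh S x = if x = 1 then 2 ^ n else 0 := by
  have h : ∑ S : Finset (Fin n), walsh S x = ∏ i, (1 + ((x i : ℤ) : ℝ)) := by
    rw [prod_one_add, powerset_univ]; rfl
  rw [h]
  split_ifs with hx
  · subst hx; norm_num
  · obtain ⟨i, hi⟩ := Function.ne_iff.1 hx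
    refine prod_eq_zero (mem_univ i) ?_
    rcases Int.units_eq_one_or (x i) with h | h
    · exact absurd h hi
    · simp [h]

/-- Plancherel formula for a convolution operator with kernel `g`. -/
theorem sum_kernel_eq_sum_walsh {n : ℕ} (f g : (Fin n → ℤˣ) → ℝ) :
    2 ^ n * ∑ x, ∑ z, g z * (f x * f (x * z)) =
      ∑ S : Finset (Fin n), (∑ z, g z * walsh S z) * (∑ x, f x * walsh S x) ^ 2 := by
  have h : ∀ S : Finset (Fin n), (∑ z, g z * walsh S z) * (∑ x, f x * walsh S x) ^ 2 =
      ∑ x, ∑ z, ∑ y, g z * f x * f y * walsh S (x * z * y) := by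
    intro S
    simp only [sq, walsh_mul, mul_sum, sum_mul]
    refine sum_congr rfl fun x _ => ?_
    rw [sum_comm]
    exact sum_congr rfl fun z _ => sum_congr rfl fun y _ => by ring
  simp only [h]
  symm
  rw [sum_comm, mul_sum]
  refine sum_congr rfl fun x _ => ?_
  rw [sum_comm, mul_sum]
  refine sum_congr rfl fun z _ => ?_
  rw [sum_comm]
  simp only [← mul_sum, sum_walsh]
  rw [sum_eq_single (x * z)]
  · rw [if_pos (cube_mul_self _)]; ring
  · intro y _ hy
    rw [if_neg, mul_zero]
    intro h
    apply hy
    rw [← mul_one (x * z), ← h, ← mul_assoc, cube_mul_self, one_mul]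
  · simp

theorem sum_units_int {M : Type*} [AddCommMonoid M] (f : ℤˣ → M) : ∑ u, f u = f 1 + f (-1) := by
  rw [UnitsInt.univ, sum_pair (by decide)]

theorem prod_ite_mem_univ {M : Type*} [CommMonoid M] {n : ℕ} (S : Finset (Fin n)) (a b : M) :
    ∏ i, (if i ∈ S then a else b) = a ^ S.card * b ^ (n - S.card) := by
  rw [prod_ite, prod_const, prod_const, filter_mem_eq_inter, univ_inter]
  congr 2
  rw [← compl_filter, filter_mem_eq_inter, univ_inter, card_compl, Fintype.card_fin]

theorem walsh_eq_prod_univ {n : ℕ} (S : Finset (Fin n)) (x : Fin n → ℤˣ) :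
    walsh S x = ∏ i, if i ∈ S then ((x i : ℤ) : ℝ) else 1 := by
  rw [prod_ite_mem, univ_inter, walsh]

theorem sum_iid_walsh {n : ℕ} (β : ℝ) (S : Finset (Fin n)) :
    ∑ z : Fin n → ℤˣ, (∏ i, if z i = 1 then 1 - β else β) * walsh S z =
      (1 - 2 * β) ^ S.card := by
  simp only [walsh_eq_prod_univ, ← prod_mul_distrib]
  rw [← Fintype.prod_sum fun (i : Fin n) (u : ℤˣ) =>
    (if u = 1 then 1 - β else β) * if i ∈ S then ((u : ℤ) : ℝ) else 1]
  have h : ∀ i : Fin n, ∑ u : ℤˣ, ((if u = 1 then 1 - β else β) *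
      if i ∈ S then ((u : ℤ) : ℝ) else 1) = if i ∈ S then 1 - 2 * β else 1 := by
    intro i
    rw [sum_units_int]
    split_ifs <;> simp_all
    ring
  simp only [h, prod_ite_mem_univ, one_pow, mul_one]

theorem sum_walsh_mul_X_pow {n : ℕ} (S : Finset (Fin n)) :
    ∑ z : Fin n → ℤˣ, C (walsh S z) * (X : ℝ[X]) ^ hammingDist z 1 =
      (1 - X) ^ S.card * (1 + X) ^ (n - S.card) := by
  have h : ∀ z : Fin n → ℤˣ, C (walsh S z) * (X : ℝ[X]) ^ hammingDist z 1 =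
      ∏ i, ((if i ∈ S then C ((z i : ℤ) : ℝ) else 1) * if z i = 1 then 1 else X) := by
    intro z
    rw [prod_mul_distrib, walsh_eq_prod_univ, map_prod]
    congr 1
    · exact prod_congr rfl fun i _ => by split_ifs <;> simp
    · rw [prod_ite, prod_const_one, prod_const, one_mul]
      rfl
  simp only [h]
  rw [← Fintype.prod_sum fun (i : Fin n) (u : ℤˣ) =>
    ((if i ∈ S then C ((u : ℤ) : ℝ) else 1) * if u = 1 then 1 else (X : ℝ[X])),
    ← prod_ite_mem_univ]
  refine prod_congr rfl fun i _ => ?_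
  rw [sum_units_int]
  split_ifs <;> simp_all
  ring

theorem sum_hBall_walsh (n r : ℕ) (S : Finset (Fin n)) :
    ∑ z ∈ hBall n r, walsh S z = ∑ i ∈ range (r + 1), krawtchouk i S.card (n - S.card) := by
  simp only [krawtchouk, ← sum_walsh_mul_X_pow, finsetSum_coeff, coeff_C_mul, coeff_X_pow]
  rw [sum_comm, hBall, sum_filter]
  refine sum_congr rfl fun z _ => ?_
  simp

theorem card_hBall (n r : ℕ) : (hBall n r).card = ballBinom n r := by
  have h := sum_hBall_walsh n r ∅
  simp only [walsh, prod_empty, card_empty, krawtchouk_zero_left, sum_const, nsmul_eq_mul,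
    mul_one, Nat.sub_zero] at h
  exact_mod_cast h

theorem BStab_eq_sum_walsh (n r : ℕ) (f : (Fin n → ℤˣ) → ℝ) :
    BStab n r f = (∑ S : Finset (Fin n),
      ballEigenvalue n r S.card * (∑ x, f x * walsh S x) ^ 2) / (2 ^ n * 2 ^ n) := by
  have hB : (ballBinom n r : ℝ) ≠ 0 := by exact_mod_cast (ballBinom_pos _ _).ne'
  have h := sum_kernel_eq_sum_walsh f fun z => if z ∈ hBall n r then 1 else 0
  simp only [ite_mul, one_mul, zero_mul, sum_ite_mem, univ_inter, sum_hBall_walsh] at h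
  simp only [BStab, ballEigenvalue, card_hBall, div_mul_eq_mul_div, ← sum_div]
  rw [← h]
  field_simp

theorem Stab_eq_sum_walsh (n : ℕ) (β : ℝ) (f : (Fin n → ℤˣ) → ℝ) :
    Stab n β f = (∑ S : Finset (Fin n),
      (1 - 2 * β) ^ S.card * (∑ x, f x * walsh S x) ^ 2) / (2 ^ n * 2 ^ n) := by
  have h := sum_kernel_eq_sum_walsh f fun z => ∏ i, if z i = 1 then 1 - β else β
  simp only [sum_iid_walsh] at h
  rw [Stab, ← h]
  field_simp

theorem sum_sq_walsh_indic_le (n : ℕ) (A : Finset (Fin n → ℤˣ)) :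
    (∑ S : Finset (Fin n), (∑ x, indic n A x * walsh S x) ^ 2) / (2 ^ n * 2 ^ n) ≤ 1 := by
  have h := sum_kernel_eq_sum_walsh (indic n A) fun z => if z = 1 then 1 else 0
  have hw : ∀ S : Finset (Fin n), walsh S 1 = 1 := fun S => by simp [walsh]
  simp only [ite_mul, one_mul, zero_mul, sum_ite_eq', mem_univ, if_true, mul_one, hw] at h
  rw [← h, mul_div_mul_left _ _ (by positivity), div_le_one (by positivity)]
  calc ∑ x, indic n A x * indic n A x ≤ ∑ _x : Fin n → ℤˣ, (1 : ℝ) :=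
        sum_le_sum fun x _ => by unfold indic; split_ifs <;> norm_num
    _ = 2 ^ n := by simp

theorem sum_mul_sq_walsh_le {n : ℕ} (A : Finset (Fin n → ℤˣ)) {u v : Finset (Fin n) → ℝ} {ε : ℝ}
    (hε : 0 ≤ ε) (h : ∀ S, ∑ x, indic n A x * walsh S x ≠ 0 → u S ≤ v S + ε) :
    (∑ S, u S * (∑ x, indic n A x * walsh S x) ^ 2) / (2 ^ n * 2 ^ n) ≤
      (∑ S, v S * (∑ x, indic n A x * walsh S x) ^ 2) / (2 ^ n * 2 ^ n) + ε := by
  have h1 := mul_le_mul_of_nonneg_left (sum_sq_walsh_indic_le n A) hε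
  rw [mul_one, ← mul_div_assoc, mul_sum] at h1
  refine le_trans ?_ (add_le_add_right h1 _)
  rw [← add_div, ← sum_add_distrib]
  gcongr with S
  rw [← add_mul]
  by_cases h0 : ∑ x, indic n A x * walsh S x = 0
  · simp [h0]
  · exact mul_le_mul_of_nonneg_right (h S h0) (sq_nonneg _)

theorem BStab_indic_le_Stab_add {n r : ℕ} {β ε : ℝ} (hε : 0 ≤ ε)
    (h : ∀ k ≤ n, ballEigenvalue n r k ≤ (1 - 2 * β) ^ k + ε) (A : Finset (Fin n → ℤˣ)) :
    BStab n r (indic n A) ≤ Stab n β (indic n A) + ε := by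
  rw [BStab_eq_sum_walsh, Stab_eq_sum_walsh]
  exact sum_mul_sq_walsh_le A hε fun S _ => h _ (card_finset_fin_le S)

theorem Stab_indic_le_one {n : ℕ} {β : ℝ} (hβ : 0 < β) (hβ2 : β ≤ 1 / 2)
    (A : Finset (Fin n → ℤˣ)) : Stab n β (indic n A) ≤ 1 := by
  have h := sum_mul_sq_walsh_le A (u := fun S => (1 - 2 * β) ^ S.card) (v := 0) zero_le_one
    fun S _ => by simpa using pow_le_one₀ (by linarith) (by linarith)
  rw [Stab_eq_sum_walsh]
  simpa using h

/-- The set of vertices of the `(m + k)`-dimensional cube whose first `m` coordinates lie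
in `A`. -/
def cylinder {m : ℕ} (k : ℕ) (A : Finset (Fin m → ℤˣ)) : Finset (Fin (m + k) → ℤˣ) :=
  univ.filter fun x => (fun i => x (Fin.castAdd k i)) ∈ A

theorem indic_cylinder_append {m k : ℕ} (A : Finset (Fin m → ℤˣ)) (a : Fin m → ℤˣ)
    (b : Fin k → ℤˣ) : indic (m + k) (cylinder k A) (Fin.append a b) = indic m A a := by
  simp [indic, cylinder]

theorem sum_append {M : Type*} [AddCommMonoid M] {m k : ℕ} (F : (Fin (m + k) → ℤˣ) → M) :
    ∑ x, F x = ∑ a : Fin m → ℤˣ, ∑ b : Fin k → ℤˣ, F (Fin.append a b) := by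
  rw [← (Fin.appendEquiv m k).sum_comp, Fintype.sum_prod_type]
  rfl

theorem card_cylinder {m : ℕ} (k : ℕ) (A : Finset (Fin m → ℤˣ)) :
    (cylinder k A).card = A.card * 2 ^ k := by
  have h : ∀ n (B : Finset (Fin n → ℤˣ)), ∑ x, indic n B x = B.card := by
    intro n B; simp [indic]
  have h1 := h _ (cylinder k A)
  rw [sum_append] at h1
  simp only [indic_cylinder_append, sum_const, ← smul_sum, h] at h1
  simp only [card_univ, Fintype.card_pi, Fintype.card_units_int, prod_const, Fintype.card_fin,
    nsmul_eq_mul, Nat.cast_pow, Nat.cast_ofNat] at h1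
  rw [mul_comm]
  exact_mod_cast h1.symm

theorem append_mul_append {m k : ℕ} (a c : Fin m → ℤˣ) (b d : Fin k → ℤˣ) :
    Fin.append a b * Fin.append c d = Fin.append (a * c) (b * d) := by
  ext i
  refine Fin.addCases (fun i => ?_) (fun i => ?_) i <;> simp

theorem Stab_cylinder {m : ℕ} (k : ℕ) (β : ℝ) (A : Finset (Fin m → ℤˣ)) :
    Stab (m + k) β (indic (m + k) (cylinder k A)) = Stab m β (indic m A) := by
  have hone : ∑ d : Fin k → ℤˣ, (∏ i, if d i = 1 then 1 - β else β) = 1 := by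
    simpa [walsh] using sum_iid_walsh (n := k) β ∅
  have h : ∀ a c : Fin m → ℤˣ,
      ∑ d : Fin k → ℤˣ, (∏ i, if Fin.append c d i = 1 then 1 - β else β) *
        (indic m A a * indic m A (a * c)) =
      (∏ i, if c i = 1 then 1 - β else β) * (indic m A a * indic m A (a * c)) := by
    intro a c
    simp only [Fin.prod_univ_add, Fin.append_left, Fin.append_right]
    rw [← sum_mul, ← mul_sum, hone, mul_one]
  rw [Stab, Stab, sum_append]
  simp only [sum_append (m := m) (k := k), append_mul_append, indic_cylinder_append]
  simp only [h, sum_const, ← smul_sum]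
  simp only [card_univ, Fintype.card_pi, Fintype.card_units_int, prod_const, Fintype.card_fin,
    nsmul_eq_mul, Nat.cast_pow, Nat.cast_ofNat]
  rw [pow_add, mul_comm (2 ^ m : ℝ), mul_div_mul_left _ _ (by positivity)]

theorem card_le_of_walsh_cylinder_ne_zero {m k : ℕ} (A : Finset (Fin m → ℤˣ))
    (S : Finset (Fin (m + k)))
    (hS : ∑ x, indic (m + k) (cylinder k A) x * walsh S x ≠ 0) : S.card ≤ m := by
  suffices h : S ⊆ univ.map (Fin.castAddEmb k) by
    simpa using card_le_card h
  intro i hi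
  induction i using Fin.addCases with
  | left i => simp
  | right j =>
    refine absurd ?_ hS
    let e : Fin (m + k) → ℤˣ := Pi.mulSingle (Fin.natAdd m j) (-1)
    have hsum := Equiv.sum_comp (Equiv.mulRight e)
      fun x => indic (m + k) (cylinder k A) x * walsh S x
    have hw : walsh S e = -1 := by
      rw [walsh, prod_eq_single_of_mem _ hi]
      · simp [e]
      · intro b _ hb
        simp [e, Pi.mulSingle_eq_of_ne hb]
    have hc : ∀ x, indic (m + k) (cylinder k A) (x * e) = indic (m + k) (cylinder k A) x := by
      intro x
      have : ∀ i : Fin m, e (Fin.castAdd k i) = 1 := fun i =>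
        Pi.mulSingle_eq_of_ne (by simp [Fin.ext_iff]; omega) _
      simp [indic, cylinder, this]
    simp only [Equiv.coe_mulRight, walsh_mul, hw, hc, mul_neg, mul_one, sum_neg_distrib] at hsum
    linarith

theorem Stab_le_BStab_cylinder_add {m k r : ℕ} {β ε : ℝ} (hε : 0 ≤ ε)
    (h : ∀ j ≤ m, (1 - 2 * β) ^ j ≤ ballEigenvalue (m + k) r j + ε)
    (A : Finset (Fin m → ℤˣ)) :
    Stab m β (indic m A) ≤ BStab (m + k) r (indic (m + k) (cylinder k A)) + ε := by
  rw [← Stab_cylinder k, BStab_eq_sum_walsh, Stab_eq_sum_walsh]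
  exact sum_mul_sq_walsh_le _ hε fun S hS => h _ (card_le_of_walsh_cylinder_ne_zero A S hS)

theorem BStab_indic_mono {n r : ℕ} {A B : Finset (Fin n → ℤˣ)} (h : A ⊆ B) :
    BStab n r (indic n A) ≤ BStab n r (indic n B) := by
  have h0 : ∀ (C : Finset (Fin n → ℤˣ)) x, 0 ≤ indic n C x := fun C x => by
    unfold indic; split_ifs <;> norm_num
  have h1 : ∀ x, indic n A x ≤ indic n B x := fun x => by
    unfold indic
    split_ifs with ha hb <;> first | exact absurd (h ha) hb | norm_num
  unfold BStab
  gcongr with x _ z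
  · exact h0 _ _
  · exact h0 _ _
  · exact h1 _
  · exact h1 _

theorem BStab_le_GammaB {n M r : ℕ} {A : Finset (Fin n → ℤˣ)} (hA : A.card = M) :
    BStab n r (indic n A) ≤ GammaB n M r := by
  refine le_csSup (Set.Finite.bddAbove ?_) ⟨A, hA, rfl⟩
  refine (Set.finite_range fun A => BStab n r (indic n A)).subset ?_
  rintro _ ⟨A, _, rfl⟩
  exact ⟨A, rfl⟩

theorem Stab_le_GammaIID {n M : ℕ} {β : ℝ} {A : Finset (Fin n → ℤˣ)} (hA : A.card = M) :
    Stab n β (indic n A) ≤ GammaIID n M β := by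
  refine le_csSup (Set.Finite.bddAbove ?_) ⟨A, hA, rfl⟩
  refine (Set.finite_range fun A => Stab n β (indic n A)).subset ?_
  rintro _ ⟨A, _, rfl⟩
  exact ⟨A, rfl⟩

theorem exists_card_eq_of_le {n M : ℕ} (hM : M ≤ 2 ^ n) :
    ∃ A : Finset (Fin n → ℤˣ), A.card = M := by
  obtain ⟨A, _, hA⟩ := exists_superset_card_eq (s := (∅ : Finset (Fin n → ℤˣ))) (n := M)
    (by simp) (by simpa using hM)
  exact ⟨A, hA⟩

theorem floor_mul_two_pow_le {α : ℝ} (hα : α ≤ 1 / 2) (n : ℕ) : ⌊α * 2 ^ n⌋₊ ≤ 2 ^ n := by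
  refine Nat.floor_le_of_le ?_
  push_cast
  have : (0 : ℝ) < 2 ^ n := by positivity
  nlinarith

theorem GammaIID_le_lim {α β : ℝ} (hα : α ≤ 1 / 2) (hβ : 0 < β) (hβ2 : β ≤ 1 / 2) (n : ℕ) :
    GammaIID n ⌊α * 2 ^ n⌋₊ β ≤ GammaIIDlim α β := by
  refine le_ciSup (f := fun n : ℕ => GammaIID n ⌊α * 2 ^ n⌋₊ β) ⟨1, ?_⟩ n
  rintro _ ⟨n, rfl⟩
  obtain ⟨A, hA⟩ := exists_card_eq_of_le (floor_mul_two_pow_le hα n)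
  refine csSup_le ⟨_, A, hA, rfl⟩ ?_
  rintro _ ⟨A, _, rfl⟩
  exact Stab_indic_le_one hβ hβ2 A

theorem tendsto_odd_radius_div {β : ℝ} (hβ : 0 < β) :
    Tendsto (fun N : ℕ => ((2 * ⌊β * (N + 1 : ℕ) / 2⌋₊ + 1 : ℕ) : ℝ) / N) atTop (𝓝 β) := by
  have hinv : Tendsto (fun N : ℕ => 1 / (N : ℝ)) atTop (𝓝 0) :=
    tendsto_const_div_atTop_nhds_zero_nat _
  have h1 : Tendsto (fun N : ℕ => (⌊β / 2 * (N + 1 : ℕ)⌋₊ : ℝ) / (N + 1 : ℕ)) atTop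
      (𝓝 (β / 2)) :=
    (tendsto_nat_floor_mul_div_atTop (by positivity)).comp
      (tendsto_natCast_atTop_atTop.comp (tendsto_add_atTop_nat 1))
  have h2 : Tendsto (fun N : ℕ => 2 * ((⌊β / 2 * (N + 1 : ℕ)⌋₊ : ℝ) / (N + 1 : ℕ)) *
      (1 + 1 / N) + 1 / N) atTop (𝓝 β) := by
    have := ((h1.const_mul 2).mul ((tendsto_const_nhds (x := (1 : ℝ))).add hinv)).add hinv
    convert this using 2
    ring
  refine h2.congr' ?_
  filter_upwards [eventually_gt_atTop 0] with N hN
  rw [show β * (N + 1 : ℕ) / 2 = β / 2 * (N + 1 : ℕ) by ring]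
  generalize ⌊β / 2 * (N + 1 : ℕ)⌋₊ = q
  push_cast
  field_simp

theorem eventually_odd_radius_le {β : ℝ} (hβ2 : β ≤ 1 / 2) :
    ∀ᶠ N : ℕ in atTop, 2 * ⌊β * (N + 1 : ℕ) / 2⌋₊ + 1 ≤ N := by
  filter_upwards [eventually_ge_atTop 3] with N hN
  have h : ⌊β * (N + 1 : ℕ) / 2⌋₊ ≤ (N + 1) / 4 := by
    refine (Nat.floor_le_floor (b := ((N + 1 : ℕ) : ℝ) / (4 : ℕ)) ?_).trans
      (Nat.floor_div_eq_div _ _).le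
    have : (0 : ℝ) ≤ (N + 1 : ℕ) := by positivity
    push_cast at this ⊢
    nlinarith
  omega

/-- from Theorem 5: for `0 < α ≤ 1/2` and `0 < β ≤ 1/2`,
`Γ_B^(n)(⌊α·2^n⌋, 2⌊βn/2⌋+1)` converges to `Γ_IID(α,β)` as `n → ∞`. -/
theorem gammaB_odd_tendsto (α β : ℝ) (hα1 : 0 < α) (hα2 : α ≤ 1 / 2)
    (hβ1 : 0 < β) (hβ2 : β ≤ 1 / 2) :
    Tendsto (fun n : ℕ => GammaB n ⌊α * 2 ^ n⌋₊ (2 * ⌊β * n / 2⌋₊ + 1)) atTop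
      (𝓝 (GammaIIDlim α β)) := by
  set r : ℕ → ℕ := fun N => 2 * ⌊β * (N + 1 : ℕ) / 2⌋₊ + 1
  have hle : ∀ᶠ N in atTop, r N ≤ N := eventually_odd_radius_le hβ2
  have hr : Tendsto (fun N : ℕ => (r N : ℝ) / N) atTop (𝓝 β) := tendsto_odd_radius_div hβ1
  rw [← tendsto_add_atTop_iff_nat 1]
  refine tendsto_order.2 ⟨fun a ha => ?_, fun a ha => ?_⟩
  · obtain ⟨m, hm⟩ := exists_lt_of_lt_ciSup (f := fun n : ℕ => GammaIID n ⌊α * 2 ^ n⌋₊ β) ha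
    obtain ⟨A, hA⟩ := exists_card_eq_of_le (floor_mul_two_pow_le hα2 m)
    obtain ⟨_, ⟨A, hA, rfl⟩, haA⟩ := exists_lt_of_lt_csSup (by exact ⟨_, A, hA, rfl⟩) hm
    obtain ⟨ε, hε, hεa⟩ : ∃ ε > 0, a + ε < Stab m β (indic m A) :=
      ⟨(Stab m β (indic m A) - a) / 2, by linarith, by linarith⟩
    have hsmall : ∀ᶠ N in atTop, ∀ j ∈ range (m + 1),
        (1 - 2 * β) ^ j - ε < ballEigenvalue (N + 1) (r N) j :=
      (eventually_all_finset _).2 fun j _ =>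
        (tendsto_ballEigenvalue hβ1 hβ2 hle hr j).eventually_const_lt (by linarith)
    filter_upwards [hsmall, eventually_ge_atTop m] with N hN hmN
    change a < GammaB (N + 1) ⌊α * 2 ^ (N + 1)⌋₊ (r N)
    generalize r N = s at hN
    obtain ⟨k, hk⟩ := Nat.exists_eq_add_of_le (hmN.trans N.le_succ)
    rw [Nat.succ_eq_add_one] at hk
    rw [hk] at hN ⊢
    have h1 := Stab_le_BStab_cylinder_add hε.le
      (fun j hj => by linarith [hN j (mem_range.2 (Nat.lt_succ_of_le hj))]) A
    have hcard : (cylinder k A).card ≤ ⌊α * 2 ^ (m + k)⌋₊ := by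
      rw [card_cylinder, hA]
      refine Nat.le_floor ?_
      push_cast
      rw [pow_add, ← mul_assoc]
      gcongr
      exact Nat.floor_le (by positivity)
    obtain ⟨B, hAB, hB⟩ := exists_superset_card_eq hcard
      (by simpa using floor_mul_two_pow_le hα2 (m + k))
    have h2 := BStab_indic_mono (r := s) hAB
    have h3 := BStab_le_GammaB (r := s) hB
    linarith
  · obtain ⟨ε, hε, hεa⟩ : ∃ ε > 0, GammaIIDlim α β + ε < a :=
      ⟨(a - GammaIIDlim α β) / 2, by linarith, by linarith⟩
    filter_upwards [eventually_ballEigenvalue_le hβ1 hβ2 hle (fun N => odd_two_mul_add_one _)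
      hr hε] with N hN
    refine lt_of_le_of_lt ?_ hεa
    obtain ⟨A, hA⟩ := exists_card_eq_of_le (floor_mul_two_pow_le hα2 (N + 1))
    refine csSup_le ⟨_, A, hA, rfl⟩ ?_
    rintro _ ⟨A, hA, rfl⟩
    have h1 := BStab_indic_le_Stab_add hε.le hN A
    have h2 := Stab_le_GammaIID (β := β) hA
    have h3 := GammaIID_le_lim hα2 hβ1 hβ2 (N + 1)
    exact h1.trans (by linarith)
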